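/- arXiv:1009.1064 — 2 statements merged into one kernel-verified Lean document; each statement's English description precedes it below -/
import Mathlib

section
/- Let n ≥ 1, let E and F be complex vector spaces, let M : Eⁿ → F be a symmetric n-linear map, and let r = exp(2πi/n) be a primitive n-th root of unity. Then for all a, b ∈ E, M(a,…,a,b) = (1/(n²(n−1)^{n−1})) · Σ_{j=0}^{n−1} r^j · M(c_j,…,c_j), where c_j = (n−1)·r^j·a + b. (For n = 1 the convention 0⁰ = 1 is used.) -/
open Finset

/-- The power sum of the powers of a primitive root of unity. -/
theorem IsPrimitiveRoot.sum_range_pow_mul {K : Type*} [Field K] {r : K} {n : ℕ}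
    (h : IsPrimitiveRoot r n) (m : ℕ) :
    ∑ j ∈ range n, (r ^ m) ^ j = if n ∣ m then (n : K) else 0 := by
  split_ifs with hm
  · simp [(h.pow_eq_one_iff_dvd m).2 hm]
  · have hne : r ^ m ≠ 1 := fun h1 => hm ((h.pow_eq_one_iff_dvd m).1 h1)
    rw [geom_sum_eq hne, ← pow_mul, mul_comm, pow_mul, h.pow_eq_one, one_pow, sub_self, zero_div]

/-- The values of a multilinear map on the line through `b` with direction `a`. -/
theorem MultilinearMap.map_const_smul_add {R ι E F : Type*} [CommSemiring R] [Fintype ι]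
    [DecidableEq ι] [AddCommMonoid E] [Module R E] [AddCommMonoid F] [Module R F]
    (M : MultilinearMap R (fun _ : ι => E) F) (c : R) (a b : E) :
    M (fun _ => c • a + b) =
      ∑ s : Finset ι, c ^ #s • M (s.piecewise (fun _ => a) (fun _ => b)) := by
  have h := M.map_add_univ (fun _ => c • a) (fun _ => b)
  refine h.trans (sum_congr rfl fun s _ => ?_)
  rw [← prod_const, ← M.map_piecewise_smul]
  congr 1
  ext i
  by_cases hi : i ∈ s <;> simp [hi]

/-- A symmetric function takes the same value at all arrangements of `n - 1` copies of `a` and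
one copy of `b`. -/
theorem map_piecewise_of_card_eq_pred {α β : Type*} {n : ℕ} (hn : 1 ≤ n)
    (f : (Fin n → α) → β) (hf : ∀ (v : Fin n → α) (σ : Equiv.Perm (Fin n)), f (v ∘ σ) = f v)
    (a b : α) (s : Finset (Fin n)) (hs : #s = n - 1) :
    f (s.piecewise (fun _ => a) (fun _ => b)) =
      f (fun i => if (i : ℕ) < n - 1 then a else b) := by
  have hc : #sᶜ = 1 := by rw [card_compl, Fintype.card_fin]; omega
  obtain ⟨k, hk⟩ := card_eq_one.1 hc
  have hmem : ∀ i, i ∈ s ↔ i ≠ k := fun i => by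
    rw [← not_iff_not, ← mem_compl, hk, mem_singleton, not_not]
  let l : Fin n := ⟨n - 1, by omega⟩
  have hl : ∀ i : Fin n, (i : ℕ) < n - 1 ↔ i ≠ l := fun i => by
    rw [Ne, Fin.ext_iff]
    have := i.isLt
    change _ ↔ ¬ (i : ℕ) = n - 1
    omega
  rw [← hf _ (Equiv.swap k l)]
  congr 1
  ext i
  have h : Equiv.swap k l i = k ↔ i = l := by
    rw [Equiv.swap_apply_eq_iff, Equiv.swap_apply_left]
  simp only [Function.comp_apply, piecewise, hmem, hl, ne_eq, h]

/-- Averaging against a root of unity selects the terms of degree `n - 1`. -/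
theorem IsPrimitiveRoot.sum_range_mul_pow {K : Type*} [Field K] {r : K} {n : ℕ}
    (h : IsPrimitiveRoot r n) (hn : 1 ≤ n) {m : ℕ} (hm : m ≤ n) :
    ∑ j ∈ range n, r ^ j * (((n : K) - 1) * r ^ j) ^ m =
      if m = n - 1 then (n : K) * ((n : K) - 1) ^ (n - 1) else 0 := by
  have key : ∑ j ∈ range n, r ^ j * (((n : K) - 1) * r ^ j) ^ m =
      ((n : K) - 1) ^ m * ∑ j ∈ range n, (r ^ (m + 1)) ^ j := by
    rw [mul_sum]
    refine sum_congr rfl fun j _ => ?_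
    rw [mul_pow]
    ring
  rw [key, h.sum_range_pow_mul]
  by_cases hmn : m = n - 1
  · subst hmn
    rw [if_pos rfl, if_pos (by rw [Nat.sub_add_cancel hn]), mul_comm]
  · rw [if_neg hmn]
    split_ifs with hd
    · obtain ⟨q, hq⟩ := hd
      have hn1 : n = 1 := by
        have : n < n * q := by
          have := Nat.le_of_dvd (Nat.succ_pos m) ⟨q, hq⟩
          omega
        have hq2 : 2 ≤ q := by
          by_contra! hlt
          interval_cases q <;> omega
        nlinarith
      subst hn1
      have : m = 1 := by omega
      simp [this]
    · rw [mul_zero]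

/-- Polarization-type formula: for a symmetric `n`-linear map `M` on complex vector spaces
and `r = exp(2πi/n)` a primitive `n`-th root of unity,
`M(a,…,a,b) = (1/(n²(n-1)^(n-1))) Σ_{j=0}^{n-1} r^j M(c_j,…,c_j)` where
`c_j = (n-1) r^j a + b`. (For `n = 1`, `0^0 = 1`.) -/
theorem symm_multilinear_polarization
    {E F : Type*} [AddCommGroup E] [Module ℂ E] [AddCommGroup F] [Module ℂ F]
    (n : ℕ) (hn : 1 ≤ n)
    (M : MultilinearMap ℂ (fun _ : Fin n => E) F)
    (hM : ∀ (v : Fin n → E) (σ : Equiv.Perm (Fin n)), M (v ∘ σ) = M v)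
    (r : ℂ) (hr : r = Complex.exp (2 * Real.pi * Complex.I / n))
    (a b : E) :
    M (fun i => if (i : ℕ) < n - 1 then a else b) =
      ((n : ℂ) ^ 2 * ((n : ℂ) - 1) ^ (n - 1))⁻¹ •
        ∑ j ∈ Finset.range n,
          r ^ j • M (fun _ => (((n : ℂ) - 1) * r ^ j) • a + b) := by
  have hprim : IsPrimitiveRoot r n := hr ▸ Complex.isPrimitiveRoot_exp n (by omega)
  have hsum : ∑ j ∈ Finset.range n, r ^ j • M (fun _ => (((n : ℂ) - 1) * r ^ j) • a + b) =
      ((n : ℂ) ^ 2 * ((n : ℂ) - 1) ^ (n - 1)) •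
        M (fun i => if (i : ℕ) < n - 1 then a else b) := by
    calc _ = ∑ s : Finset (Fin n),
          (∑ j ∈ range n, r ^ j * (((n : ℂ) - 1) * r ^ j) ^ #s) •
            M (s.piecewise (fun _ => a) (fun _ => b)) := by
          simp_rw [M.map_const_smul_add, smul_sum, sum_smul, smul_smul]
          exact sum_comm
      _ = ∑ s : Finset (Fin n), if #s = n - 1 then
            ((n : ℂ) * ((n : ℂ) - 1) ^ (n - 1)) •
              M (fun i => if (i : ℕ) < n - 1 then a else b) else 0 := by
          refine sum_congr rfl fun s _ => ?_
          rw [hprim.sum_range_mul_pow hn (card_finset_fin_le s)]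
          split_ifs with hs
          · rw [map_piecewise_of_card_eq_pred hn M hM a b s hs]
          · rw [zero_smul]
      _ = _ := by
          have hcard : #{s : Finset (Fin n) | #s = n - 1} = n := by
            rw [← Fintype.card_subtype, Fintype.card_finset_len, Fintype.card_fin,
              Nat.choose_symm hn, Nat.choose_one_right]
          rw [← sum_filter, sum_const, hcard, ← Nat.cast_smul_eq_nsmul ℂ, smul_smul,
            ← mul_assoc, ← sq]
  have hne : (n : ℂ) ^ 2 * ((n : ℂ) - 1) ^ (n - 1) ≠ 0 := by
    refine mul_ne_zero (pow_ne_zero _ (by exact_mod_cast (by omega : n ≠ 0))) ?_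
    obtain rfl | h1 := hn.eq_or_lt
    · simp
    · exact pow_ne_zero _ (sub_ne_zero.2 (by exact_mod_cast h1.ne'))
  rw [hsum, inv_smul_smul₀ hne]
end

section
/- Let n ≥ 2, let E, F, G be complex Banach spaces, let M : Eⁿ → F be a continuous symmetric n-linear map, and let T, S : G → E be continuous linear operators. Define Q : G → F by Q(x) = M(Tx,…,Tx,Sx) (with n−1 arguments equal to Tx and one equal to Sx). Then sup_{‖x‖≤1} ‖Q(x)‖ ≤ (n/(n−1))^{n−1} · ‖T‖^{n−1} · ‖S‖ · sup_{‖y‖≤1} ‖M(y,…,y)‖, and in particular the left-hand side is at most e · ‖T‖^{n−1} · ‖S‖ · sup_{‖y‖≤1} ‖M(y,…,y)‖. -/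
open Finset

/-- The sup norm of a (polynomial) map on the closed unit ball. -/
noncomputable def polyNorm {E F : Type*} [NormedAddCommGroup E] [NormedSpace ℂ E]
    [NormedAddCommGroup F] [NormedSpace ℂ F] (P : E → F) : ℝ :=
  ⨆ x : (Metric.closedBall (0 : E) 1), ‖P x.1‖

section

variable {E F : Type*} [NormedAddCommGroup E] [NormedSpace ℂ E]
  [NormedAddCommGroup F] [NormedSpace ℂ F]

theorem polyNorm_nonneg (P : E → F) : 0 ≤ polyNorm P :=
  Real.iSup_nonneg fun _ => norm_nonneg _

theorem polyNorm_le {P : E → F} {C : ℝ} (h : ∀ x, ‖x‖ ≤ 1 → ‖P x‖ ≤ C) : polyNorm P ≤ C := by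
  have : Nonempty (Metric.closedBall (0 : E) 1) := ⟨⟨0, by simp⟩⟩
  exact ciSup_le fun x => h x.1 (mem_closedBall_zero_iff.1 x.2)

namespace ContinuousMultilinearMap

variable {n : ℕ} (M : ContinuousMultilinearMap ℂ (fun _ : Fin n => E) F)

theorem norm_diag_le_polyNorm {y : E} (hy : ‖y‖ ≤ 1) :
    ‖M fun _ => y‖ ≤ polyNorm (fun y => M fun _ => y) := by
  have hb : BddAbove (Set.range fun x : (Metric.closedBall (0 : E) 1) => ‖M fun _ => x.1‖) := by
    refine ⟨‖M‖, ?_⟩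
    rintro _ ⟨x, rfl⟩
    have hx : ‖x.1‖ ≤ 1 := mem_closedBall_zero_iff.1 x.2
    refine (M.le_opNorm _).trans (mul_le_of_le_one_right (norm_nonneg _) ?_)
    exact Finset.prod_le_one (fun _ _ => norm_nonneg _) fun _ _ => hx
  exact le_ciSup hb ⟨y, by simpa using hy⟩

theorem norm_diag_le_polyNorm_mul_pow {y : E} {r : ℝ} (hr : 0 < r) (hy : ‖y‖ ≤ r) :
    ‖M fun _ => y‖ ≤ polyNorm (fun y => M fun _ => y) * r ^ n := by
  have hrC : (r : ℂ) ≠ 0 := by exact_mod_cast hr.ne'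
  have h1 : ‖(r : ℂ)⁻¹ • y‖ ≤ 1 := by
    rw [norm_smul, norm_inv, Complex.norm_real, Real.norm_of_nonneg hr.le, inv_mul_le_iff₀ hr]
    simpa using hy
  have h2 : (M fun _ => y) = (r : ℂ) ^ n • M fun _ => (r : ℂ)⁻¹ • y := by
    have := M.map_smul_univ (fun _ => (r : ℂ)) (fun _ => (r : ℂ)⁻¹ • y)
    simpa [smul_smul, hrC] using this
  rw [h2, norm_smul, norm_pow, Complex.norm_real, Real.norm_of_nonneg hr.le, mul_comm]
  exact mul_le_mul_of_nonneg_right (M.norm_diag_le_polyNorm h1) (by positivity)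

theorem hasDerivAt_diag_add_smul (a b : E) :
    HasDerivAt (fun z : ℂ => M fun _ => a + z • b)
      (∑ i, M (Function.update (fun _ => a) i b)) 0 := by
  have hg : HasDerivAt (fun (z : ℂ) (_ : Fin n) => a + z • b) (fun _ => b) 0 := by
    rw [hasDerivAt_pi]
    intro _
    simpa using ((hasDerivAt_id (0 : ℂ)).smul_const b).const_add a
  have h := (M.hasFDerivAt (fun _ => a + (0 : ℂ) • b)).comp_hasDerivAt (0 : ℂ) hg
  simpa [Function.comp_def, linearDeriv_apply] using h

theorem differentiable_diag_add_smul (a b : E) :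
    Differentiable ℂ (fun z : ℂ => M fun _ => a + z • b) := fun z =>
  (M.hasFDerivAt _).differentiableAt.comp z
    (f := fun (z : ℂ) (_ : Fin n) => a + z • b) (by fun_prop)

/-- A symmetric map sees the position of the exceptional argument only up to permutation. -/
theorem map_update_const_eq_of_symmetric
    (hM : ∀ (v : Fin n → E) (σ : Equiv.Perm (Fin n)), M (v ∘ σ) = M v) (a b : E) (i : Fin n) :
    M (Function.update (fun _ => a) i b) = M fun j => if (j : ℕ) < n - 1 then a else b := by
  have hn : n - 1 < n := by have := i.2; omega
  rw [← hM (fun j => if (j : ℕ) < n - 1 then a else b) (Equiv.swap i ⟨n - 1, hn⟩)]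
  congr 1
  ext1 j
  have hj := j.2
  have hi := i.2
  simp only [Function.update_apply, Function.comp_apply, Equiv.swap_apply_def, Fin.ext_iff]
  split_ifs <;> simp_all <;> omega

/-- The Cauchy estimate on a circle of radius `r` for the coefficient `n M(a, …, a, b)`. -/
theorem norm_map_one_exceptional_le_of_symmetric
    (hM : ∀ (v : Fin n → E) (σ : Equiv.Perm (Fin n)), M (v ∘ σ) = M v) {a b : E} {α β r : ℝ}
    (hα : 0 < α) (hβ : 0 < β) (ha : ‖a‖ ≤ α) (hb : ‖b‖ ≤ β) (hr : 0 < r) :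
    n * ‖M fun j => if (j : ℕ) < n - 1 then a else b‖ ≤
      polyNorm (fun y => M fun _ => y) * (α + r * β) ^ n / r := by
  have h := Complex.norm_deriv_le_of_forall_mem_sphere_norm_le (c := 0) hr
    (M.differentiable_diag_add_smul a b).diffContOnCl
    (C := polyNorm (fun y => M fun _ => y) * (α + r * β) ^ n) fun z hz => by
      have hz : ‖z‖ = r := by simpa using hz
      refine M.norm_diag_le_polyNorm_mul_pow (by positivity) ((norm_add_le _ _).trans ?_)
      rw [norm_smul, hz]
      gcongr
  rw [(M.hasDerivAt_diag_add_smul a b).deriv] at h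
  simpa [M.map_update_const_eq_of_symmetric hM, ← Nat.cast_smul_eq_nsmul ℂ, norm_smul] using h

theorem norm_map_one_exceptional_le_polyNorm (hn : 2 ≤ n)
    (hM : ∀ (v : Fin n → E) (σ : Equiv.Perm (Fin n)), M (v ∘ σ) = M v) {a b : E} {α β : ℝ}
    (ha : ‖a‖ ≤ α) (hb : ‖b‖ ≤ β) :
    ‖M fun j => if (j : ℕ) < n - 1 then a else b‖ ≤
      ((n : ℝ) / ((n : ℝ) - 1)) ^ (n - 1) * α ^ (n - 1) * β * polyNorm (fun y => M fun _ => y) := by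
  have hn1 : (0 : ℝ) < (n : ℝ) - 1 := by
    have : (2 : ℝ) ≤ n := by exact_mod_cast hn
    linarith
  have hK := polyNorm_nonneg (fun y => M fun _ => y)
  have hα := (norm_nonneg a).trans ha
  have hβ := (norm_nonneg b).trans hb
  have hR : 0 ≤ ((n : ℝ) / ((n : ℝ) - 1)) ^ (n - 1) * α ^ (n - 1) * β *
      polyNorm (fun y => M fun _ => y) := by positivity
  rcases hα.eq_or_lt with rfl | hα
  · have ha : a = 0 := by simpa using ha
    have : (M fun j => if (j : ℕ) < n - 1 then a else b) = 0 :=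
      M.map_coord_zero ⟨0, by omega⟩ (by simp [ha]; omega)
    rwa [this, norm_zero]
  rcases hβ.eq_or_lt with rfl | hβ
  · have hb : b = 0 := by simpa using hb
    have : (M fun j => if (j : ℕ) < n - 1 then a else b) = 0 :=
      M.map_coord_zero ⟨n - 1, by omega⟩ (by simp [hb])
    rwa [this, norm_zero]
  have h := M.norm_map_one_exceptional_le_of_symmetric hM hα hβ ha hb
    (r := α / (((n : ℝ) - 1) * β)) (by positivity)
  have hn0 : (0 : ℝ) < n := by linarith
  refine le_of_mul_le_mul_left (h.trans_eq ?_) hn0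
  have hs : α + α / (((n : ℝ) - 1) * β) * β = (n : ℝ) / ((n : ℝ) - 1) * α := by
    field_simp
    ring
  have hp : ((n : ℝ) / ((n : ℝ) - 1) * α) ^ n =
      (n : ℝ) / ((n : ℝ) - 1) * α * ((n : ℝ) / ((n : ℝ) - 1) * α) ^ (n - 1) := by
    rw [← pow_succ', Nat.sub_add_cancel (by omega)]
  rw [hs, hp, mul_pow]
  generalize ((n : ℝ) / ((n : ℝ) - 1)) ^ (n - 1) = A
  generalize α ^ (n - 1) = B
  field_simp

end ContinuousMultilinearMap

end

theorem div_sub_one_pow_le_exp_one {n : ℕ} (hn : 2 ≤ n) :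
    ((n : ℝ) / ((n : ℝ) - 1)) ^ (n - 1) ≤ Real.exp 1 := by
  have hn1 : (0 : ℝ) < (n : ℝ) - 1 := by
    have : (2 : ℝ) ≤ n := by exact_mod_cast hn
    linarith
  have h : (n : ℝ) / ((n : ℝ) - 1) = 1 / ((n : ℝ) - 1) + 1 := by
    field_simp
    ring
  rw [h]
  refine (pow_le_pow_left₀ (by positivity) (Real.add_one_le_exp _) _).trans_eq ?_
  rw [← Real.exp_nat_mul, Nat.cast_sub (by omega), Nat.cast_one, mul_one_div_cancel hn1.ne']

/-- For a continuous symmetric `n`-linear map `M : Eⁿ → F` and operators `T, S : G → E`,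
the `n`-homogeneous polynomial `Q(x) = M(Tx, …, Tx, Sx)` satisfies
`‖Q‖ ≤ (n/(n-1))^(n-1) ‖T‖^(n-1) ‖S‖ ‖y ↦ M(y,…,y)‖`, and in particular
`‖Q‖ ≤ e ‖T‖^(n-1) ‖S‖ ‖y ↦ M(y,…,y)‖`. -/
theorem polyNorm_compose_two_operators_le
    {E F G : Type*} [NormedAddCommGroup E] [NormedSpace ℂ E] [CompleteSpace E]
    [NormedAddCommGroup F] [NormedSpace ℂ F] [CompleteSpace F]
    [NormedAddCommGroup G] [NormedSpace ℂ G] [CompleteSpace G]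
    (n : ℕ) (hn : 2 ≤ n)
    (M : ContinuousMultilinearMap ℂ (fun _ : Fin n => E) F)
    (hM : ∀ (v : Fin n → E) (σ : Equiv.Perm (Fin n)), M (v ∘ σ) = M v)
    (T S : G →L[ℂ] E) :
    polyNorm (fun x => M fun i => if (i : ℕ) < n - 1 then T x else S x)
        ≤ ((n : ℝ) / ((n : ℝ) - 1)) ^ (n - 1) * ‖T‖ ^ (n - 1) * ‖S‖ *
            polyNorm (fun y => M fun _ => y) ∧
      polyNorm (fun x => M fun i => if (i : ℕ) < n - 1 then T x else S x)
        ≤ Real.exp 1 * ‖T‖ ^ (n - 1) * ‖S‖ * polyNorm (fun y => M fun _ => y) := by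
  have h : polyNorm (fun x => M fun i => if (i : ℕ) < n - 1 then T x else S x)
      ≤ ((n : ℝ) / ((n : ℝ) - 1)) ^ (n - 1) * ‖T‖ ^ (n - 1) * ‖S‖ *
          polyNorm (fun y => M fun _ => y) :=
    polyNorm_le fun x hx => M.norm_map_one_exceptional_le_polyNorm hn hM
      (T.unit_le_opNorm x hx) (S.unit_le_opNorm x hx)
  refine ⟨h, h.trans ?_⟩
  have hK := polyNorm_nonneg (fun y => M fun _ => y)
  gcongr
  exact div_sub_one_pow_le_exp_one hn
end
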